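/- Let T be a tree with n vertices whose vertices are colored with k ≥ 2 colors in ratio c_1:c_2:…:c_k, where the c_i are positive integers with gcd(c_1,…,c_k)=1 and d = c_1+…+c_k, and suppose (d²−3d+4)n − 2d > 0. Then every fair partition 𝒫 of the vertices of T all of whose parts have size d satisfies cost(T,𝒫) ≤ α · cost(T,𝒬) for every fair partition 𝒬 of the vertices of T, where α = ((d²+d)n − 2d) / ((d²−3d+4)n − 2d). -/

import Mathlib

open Finset

/-- Two vertices lie in a common block of the clustering `P`. -/
def SameBlock {V : Type*} (P : Finset (Finset V)) (u v : V) : Prop :=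
  ∃ S ∈ P, u ∈ S ∧ v ∈ S

/-- Inter-cluster cost: the number of edges whose endpoints lie in different blocks of `P`. -/
noncomputable def interCost {V : Type*} (G : SimpleGraph V) (P : Finset (Finset V)) : ℕ :=
  {e : Sym2 V | e ∈ G.edgeSet ∧ ∃ u ∈ e, ∃ v ∈ e, ¬ SameBlock P u v}.ncard

/-- Intra-cluster cost: the number of non-adjacent pairs of distinct vertices lying in a
common block of `P`. -/
noncomputable def intraCost {V : Type*} (G : SimpleGraph V) (P : Finset (Finset V)) : ℕ :=
  {e : Sym2 V | ¬ e.IsDiag ∧ e ∉ G.edgeSet ∧ ∀ u ∈ e, ∀ v ∈ e, SameBlock P u v}.ncard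

/-- The correlation clustering cost of a clustering `P` on the graph `G`. -/
noncomputable def ccCost {V : Type*} (G : SimpleGraph V) (P : Finset (Finset V)) : ℕ :=
  intraCost G P + interCost G P

/-- A set `S` is fair w.r.t. the coloring `col`: for each color, the fraction of `S`
of that color equals the global fraction (stated by cross multiplication). -/
def FairSet {V : Type*} [Fintype V] {k : ℕ} (col : V → Fin k) (S : Finset V) : Prop :=
  ∀ i : Fin k,
    (S.filter fun v => col v = i).card * Fintype.card V
      = (Finset.univ.filter fun v => col v = i).card * S.card

section Clustering

variable {V : Type*} [Fintype V]

theorem interCost_le_card_edgeSet (G : SimpleGraph V) (P : Finset (Finset V)) :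
    interCost G P ≤ G.edgeSet.ncard :=
  Set.ncard_le_ncard fun _ he => he.1

/-- If the colors are in ratio `cs` with coprime entries, fair sets have size divisible
by the sum of the entries. -/
theorem FairSet.sum_dvd_card [Nonempty V] {k : ℕ} {col : V → Fin k} {cs : Fin k → ℕ}
    (hgcd : univ.gcd cs = 1)
    (hratio : ∀ i : Fin k,
      (univ.filter fun v => col v = i).card * (∑ j, cs j) = cs i * Fintype.card V)
    {S : Finset V} (hS : FairSet col S) : ∑ j, cs j ∣ S.card := by
  have h : ∀ i ∈ univ, ∑ j, cs j ∣ cs i * S.card := fun i _ => by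
    refine ⟨(S.filter fun v => col v = i).card, ?_⟩
    refine Nat.eq_of_mul_eq_mul_right (Fintype.card_pos (α := V)) ?_
    calc cs i * S.card * Fintype.card V
        = cs i * Fintype.card V * S.card := by ring
      _ = (∑ j, cs j) * ((univ.filter fun v => col v = i).card * S.card) := by
        rw [← hratio i]; ring
      _ = _ := by rw [← hS i]; ring
  have := dvd_gcd h
  rwa [Finset.gcd_mul_right, hgcd, one_mul, normalize_eq] at this

variable [DecidableEq V]

theorem sameBlock_iff_part_eq (P : Finpartition (univ : Finset V)) (u v : V) :
    SameBlock P.parts u v ↔ P.part u = P.part v := by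
  rw [← P.mem_part_iff_part_eq_part (mem_univ u) (mem_univ v), P.mem_part_iff_exists]
  rfl

/-- The unordered pairs of distinct vertices lying in a common block, counted block by block. -/
theorem ncard_pairs_sameBlock (P : Finpartition (univ : Finset V)) :
    {e : Sym2 V | ¬ e.IsDiag ∧ ∀ u ∈ e, ∀ v ∈ e, SameBlock P.parts u v}.ncard
      = ∑ S ∈ P.parts, S.card.choose 2 := by
  have h : {e : Sym2 V | ¬ e.IsDiag ∧ ∀ u ∈ e, ∀ v ∈ e, SameBlock P.parts u v}
      = ↑(P.parts.biUnion fun S => S.offDiag.image Sym2.mk.uncurry) := by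
    ext e
    induction e with | _ a b
    simp only [Set.mem_ofPred_eq, Sym2.mk_isDiag_iff, Sym2.mem_iff, coe_biUnion, mem_coe,
      Set.mem_iUnion, mem_image, mem_offDiag, Prod.exists, Function.uncurry_apply_pair,
      exists_prop]
    constructor
    · rintro ⟨hab, h⟩
      obtain ⟨S, hS, ha, hb⟩ := h a (.inl rfl) b (.inr rfl)
      exact ⟨S, hS, a, b, ⟨ha, hb, hab⟩, rfl⟩
    · rintro ⟨S, hS, x, y, ⟨hx, hy, hxy⟩, he⟩
      rcases Sym2.eq_iff.1 he with ⟨rfl, rfl⟩ | ⟨rfl, rfl⟩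
      · refine ⟨hxy, ?_⟩
        rintro u (rfl | rfl) v (rfl | rfl) <;> exact ⟨S, hS, ‹_›, ‹_›⟩
      · refine ⟨hxy.symm, ?_⟩
        rintro u (rfl | rfl) v (rfl | rfl) <;> exact ⟨S, hS, ‹_›, ‹_›⟩
  rw [h, Set.ncard_coe_finset, card_biUnion]
  · exact sum_congr rfl fun S _ => Sym2.card_image_offDiag S
  · intro S hS S' hS' hne
    refine Finset.disjoint_left.2 fun e he he' => hne ?_
    simp only [mem_image, mem_offDiag, Prod.exists, Function.uncurry_apply_pair] at he he'
    obtain ⟨a, b, ⟨ha, -, -⟩, rfl⟩ := he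
    obtain ⟨x, y, ⟨hx, hy, -⟩, hxy⟩ := he'
    have ha' : a ∈ S' := by
      rcases Sym2.eq_iff.1 hxy with ⟨rfl, rfl⟩ | ⟨rfl, rfl⟩ <;> assumption
    exact (P.part_eq_of_mem hS ha).symm.trans (P.part_eq_of_mem hS' ha')

/-- Every edge inside a block saves one pair of the block and is not cut. -/
theorem ccCost_add_card_edgeSet (G : SimpleGraph V) (P : Finpartition (univ : Finset V)) :
    ccCost G P.parts + G.edgeSet.ncard
      = ∑ S ∈ P.parts, S.card.choose 2 + 2 * interCost G P.parts := by
  set A := {e : Sym2 V | e ∈ G.edgeSet ∧ ∀ u ∈ e, ∀ v ∈ e, SameBlock P.parts u v} with hA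
  have hpairs : A.ncard + intraCost G P.parts = ∑ S ∈ P.parts, S.card.choose 2 := by
    rw [← ncard_pairs_sameBlock, intraCost, ← Set.ncard_union_eq]
    · congr 1
      ext e
      have := G.not_isDiag_of_mem_edgeSet (e := e)
      simp only [hA, Set.mem_union, Set.mem_ofPred_eq]
      tauto
    · exact Set.disjoint_left.2 fun e he he' => he'.2.1 he.1
  have hedges : A.ncard + interCost G P.parts = G.edgeSet.ncard := by
    rw [interCost, ← Set.ncard_union_eq]
    · congr 1
      ext e
      simp only [hA, Set.mem_union, Set.mem_ofPred_eq, ← and_or_left]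
      refine and_iff_left ?_
      by_contra! h
      obtain ⟨⟨u, hu, v, hv, huv⟩, h⟩ := h
      exact huv (h u hu v hv)
    · exact Set.disjoint_left.2 fun e ⟨_, h⟩ ⟨_, u, hu, v, hv, huv⟩ => huv (h u hu v hv)
  rw [ccCost]
  omega

/-- Contracting the blocks of a partition of a connected graph leaves a connected graph, so at
least `#parts - 1` edges are cut. -/
theorem card_parts_le_interCost_add_one {G : SimpleGraph V} (hG : G.Connected)
    (P : Finpartition (univ : Finset V)) :
    P.parts.card ≤ interCost G P.parts + 1 := by
  let f : V → P.parts := fun v => ⟨P.part v, P.part_mem.2 (mem_univ v)⟩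
  have hf (u v : V) : f u = f v ↔ SameBlock P.parts u v := by
    rw [sameBlock_iff_part_eq, Subtype.mk.injEq]
  let R : SimpleGraph P.parts := SimpleGraph.fromRel fun a b => ∃ u v, G.Adj u v ∧ f u = a ∧ f v = b
  have hsurj (a : P.parts) : ∃ v, f v = a := by
    obtain ⟨v, hv⟩ := P.nonempty_of_mem_parts a.2
    exact ⟨v, Subtype.ext (P.part_eq_of_mem a.2 hv)⟩
  have hwalk {u v : V} (w : G.Walk u v) : R.Reachable (f u) (f v) := by
    induction w with
    | nil => exact .refl _
    | @cons u v _ h _ ih =>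
      refine SimpleGraph.Reachable.trans ?_ ih
      by_cases huv : f u = f v
      · rw [huv]
      · exact SimpleGraph.Adj.reachable
          ((SimpleGraph.fromRel_adj _ _ _).2 ⟨huv, .inl ⟨u, v, h, rfl, rfl⟩⟩)
  have hR : R.Connected := by
    have := hG.nonempty.map f
    refine ⟨fun a b => ?_⟩
    obtain ⟨u, rfl⟩ := hsurj a
    obtain ⟨v, rfl⟩ := hsurj b
    obtain ⟨w⟩ := hG.preconnected u v
    exact hwalk w
  have hsub : R.edgeSet ⊆ Sym2.map f ''
      {e : Sym2 V | e ∈ G.edgeSet ∧ ∃ u ∈ e, ∃ v ∈ e, ¬ SameBlock P.parts u v} := by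
    intro e he
    induction e with | _ a b
    obtain ⟨hab, ⟨u, v, huv, rfl, rfl⟩ | ⟨u, v, huv, rfl, rfl⟩⟩ :=
      (SimpleGraph.fromRel_adj _ _ _).1 ((SimpleGraph.mem_edgeSet _).1 he)
    · exact ⟨s(u, v), ⟨huv, u, by simp, v, by simp, (hf u v).not.1 hab⟩, by simp⟩
    · exact ⟨s(u, v), ⟨huv, v, by simp, u, by simp, (hf v u).not.1 hab⟩, by simp [Sym2.eq_swap]⟩
  have hcard := hR.card_vert_le_card_edgeSet_add_one
  rw [Nat.card_eq_fintype_card, Fintype.card_coe, Nat.card_coe_set_eq] at hcard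
  have := (Set.ncard_le_ncard hsub).trans (Set.ncard_image_le (Set.toFinite _))
  rw [interCost]
  omega

theorem cast_sum_card_parts (P : Finpartition (univ : Finset V)) :
    ∑ S ∈ P.parts, (S.card : ℚ) = Fintype.card V := by
  exact_mod_cast P.sum_card_parts

theorem two_mul_ccCost_le_of_card_eq {T : SimpleGraph V}
    (hT : T.edgeSet.ncard + 1 = Fintype.card V) {d : ℕ} (P : Finpartition (univ : Finset V))
    (hP : ∀ S ∈ P.parts, S.card = d) :
    2 * d * (ccCost T P.parts : ℚ) ≤ ((d : ℚ) ^ 2 + d) * Fintype.card V - 2 * d := by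
  have hcost : (ccCost T P.parts : ℚ) + T.edgeSet.ncard
      = ∑ S ∈ P.parts, (S.card.choose 2 : ℚ) + 2 * interCost T P.parts := by
    exact_mod_cast ccCost_add_card_edgeSet T P
  have hinter : (interCost T P.parts : ℚ) ≤ T.edgeSet.ncard := by
    exact_mod_cast interCost_le_card_edgeSet T P.parts
  have hedge : (T.edgeSet.ncard : ℚ) + 1 = Fintype.card V := by exact_mod_cast hT
  have hpairs : ∑ S ∈ P.parts, (S.card.choose 2 : ℚ) = Fintype.card V * ((d - 1) / 2) := by
    rw [← cast_sum_card_parts P, sum_mul]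
    refine sum_congr rfl fun S hS => ?_
    rw [Nat.cast_choose_two, hP S hS]
    ring
  have : (ccCost T P.parts : ℚ) ≤ Fintype.card V * ((d - 1) / 2) + Fintype.card V - 1 := by
    linarith
  calc 2 * d * (ccCost T P.parts : ℚ)
      ≤ 2 * d * (Fintype.card V * ((d - 1) / 2) + Fintype.card V - 1) := by gcongr
    _ = _ := by ring

theorem le_two_mul_ccCost_of_le_card {T : SimpleGraph V} (hconn : T.Connected)
    (hT : T.edgeSet.ncard + 1 = Fintype.card V) {d : ℕ} (hd : 2 ≤ d)
    (Q : Finpartition (univ : Finset V)) (hQ : ∀ S ∈ Q.parts, d ≤ S.card) :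
    ((d : ℚ) ^ 2 - 3 * d + 4) * Fintype.card V - 2 * d ≤ 2 * d * (ccCost T Q.parts : ℚ) := by
  have hcost : (ccCost T Q.parts : ℚ) + T.edgeSet.ncard
      = ∑ S ∈ Q.parts, (S.card.choose 2 : ℚ) + 2 * interCost T Q.parts := by
    exact_mod_cast ccCost_add_card_edgeSet T Q
  have hinter : (Q.parts.card : ℚ) ≤ interCost T Q.parts + 1 := by
    exact_mod_cast card_parts_le_interCost_add_one hconn Q
  have hedge : (T.edgeSet.ncard : ℚ) + 1 = Fintype.card V := by exact_mod_cast hT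
  have hd' : (2 : ℚ) ≤ d := by exact_mod_cast hd
  have hpairs : ((d : ℚ) ^ 2 - d + 4) * Fintype.card V
      ≤ 2 * d * (∑ S ∈ Q.parts, (S.card.choose 2 : ℚ) + 2 * Q.parts.card) := by
    have : ∑ S ∈ Q.parts, (S.card.choose 2 : ℚ) + 2 * Q.parts.card
        = ∑ S ∈ Q.parts, ((S.card.choose 2 : ℚ) + 2) := by
      rw [sum_add_distrib, sum_const, nsmul_eq_mul, mul_comm (2 : ℚ)]
    rw [this, ← cast_sum_card_parts Q, mul_sum, mul_sum]
    refine sum_le_sum fun S hS => ?_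
    have hs : (d : ℚ) ≤ S.card := by exact_mod_cast hQ S hS
    rw [Nat.cast_choose_two]
    have h4 : 0 ≤ (d : ℚ) * S.card - 4 := by nlinarith
    linarith [mul_nonneg (sub_nonneg.2 hs) h4]
  have : ∑ S ∈ Q.parts, (S.card.choose 2 : ℚ) + 2 * Q.parts.card
      ≤ ccCost T Q.parts + Fintype.card V + 1 := by
    linarith
  have := mul_le_mul_of_nonneg_left this (by positivity : (0 : ℚ) ≤ 2 * d)
  linarith

end Clustering

/-- For a tree with `n` vertices and `k ≥ 2` colors in ratio
`c₁ : … : c_k` (coprime positive integers with sum `d`), if `(d²-3d+4)n - 2d > 0`,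
then every fair partition with all parts of size `d` is an `α`-approximation for
fair correlation clustering, where `α = ((d²+d)n - 2d) / ((d²-3d+4)n - 2d)`. -/
theorem stmt19 {V : Type*} [Fintype V] [DecidableEq V]
    (T : SimpleGraph V) (hT : T.IsTree)
    (k : ℕ) (hk : 2 ≤ k) (col : V → Fin k) (cs : Fin k → ℕ)
    (hpos : ∀ i, 0 < cs i) (hgcd : Finset.univ.gcd cs = 1)
    (hratio : ∀ i : Fin k,
      (Finset.univ.filter fun v => col v = i).card * (∑ j, cs j)
        = cs i * Fintype.card V)
    (d : ℕ) (hdsum : d = ∑ j, cs j)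
    (hdenom : 0 < ((d : ℚ) ^ 2 - 3 * d + 4) * (Fintype.card V : ℚ) - 2 * (d : ℚ)) :
    ∀ P : Finpartition (Finset.univ : Finset V),
      (∀ S ∈ P.parts, FairSet col S) → (∀ S ∈ P.parts, S.card = d) →
      ∀ Q : Finpartition (Finset.univ : Finset V),
        (∀ S ∈ Q.parts, FairSet col S) →
        (ccCost T P.parts : ℚ)
          ≤ (((d : ℚ) ^ 2 + d) * (Fintype.card V : ℚ) - 2 * (d : ℚ))
              / (((d : ℚ) ^ 2 - 3 * d + 4) * (Fintype.card V : ℚ) - 2 * (d : ℚ))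
            * (ccCost T Q.parts : ℚ) := by
  intro P _ hPd Q hQ
  classical
  have := hT.connected.nonempty
  have hedge : T.edgeSet.ncard + 1 = Fintype.card V := by
    rw [← hT.card_edgeFinset, ← SimpleGraph.coe_edgeFinset, Set.ncard_coe_finset]
  have hd : 2 ≤ d := by
    have h : ∑ _j : Fin k, 1 ≤ ∑ j, cs j := sum_le_sum fun j _ => hpos j
    rw [sum_const, card_univ, Fintype.card_fin, smul_eq_mul, mul_one] at h
    omega
  have hQd : ∀ S ∈ Q.parts, d ≤ S.card := fun S hS =>
    hdsum ▸ Nat.le_of_dvd (Q.nonempty_of_mem_parts hS).card_pos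
      ((hQ S hS).sum_dvd_card hgcd hratio)
  have hupper := two_mul_ccCost_le_of_card_eq hedge P hPd
  have hlower := le_two_mul_ccCost_of_le_card hT.connected hedge hd Q hQd
  have hd0 : (0 : ℚ) < 2 * d := by positivity
  rw [div_mul_eq_mul_div, le_div_iff₀ hdenom]
  refine le_of_mul_le_mul_left ?_ hd0
  calc 2 * d * ((ccCost T P.parts : ℚ) * _)
      = 2 * d * (ccCost T P.parts : ℚ) * _ := (mul_assoc _ _ _).symm
    _ ≤ _ * (2 * d * (ccCost T Q.parts : ℚ)) :=
      mul_le_mul hupper hlower hdenom.le (le_trans (by positivity) hupper)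
    _ = _ := by ring
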